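/- Let E be a complex normed space containing a nonzero vector, and let T : E → E be an additive, conjugate-linear (T(c • x) = conj(c) • T(x) for all c ∈ ℂ, x ∈ E), norm-preserving map (‖T x‖ = ‖x‖ for all x). If there is u ∈ ℂ such that T (T x) = u • x for all x ∈ E, then u = 1 or u = -1. -/

import Mathlib

/-- If a norm-preserving conjugate-linear map `T` on a nontrivial complex normed space squares
to a scalar `u` times the identity, then `u = 1` or `u = -1`. -/
theorem antiunitary_square_scalar_pm_one
    {E : Type*} [NormedAddCommGroup E] [NormedSpace ℂ E]
    (hE : ∃ x : E, x ≠ 0)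
    (T : E → E)
    (hadd : ∀ x y : E, T (x + y) = T x + T y)
    (hsmul : ∀ (c : ℂ) (x : E), T (c • x) = (starRingEnd ℂ c) • T x)
    (hnorm : ∀ x : E, ‖T x‖ = ‖x‖)
    (u : ℂ) (hu : ∀ x : E, T (T x) = u • x) :
    u = 1 ∨ u = -1 := by
  obtain ⟨x, hx⟩ := hE
  have hTx : T x ≠ 0 := by rwa [← norm_ne_zero_iff, hnorm, norm_ne_zero_iff]
  have hconj : starRingEnd ℂ u = u := by
    apply smul_left_injective ℂ hTx
    change starRingEnd ℂ u • T x = u • T x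
    rw [← hsmul, ← hu x, hu (T x)]
  have hunit : ‖u‖ = 1 := by
    apply mul_right_cancel₀ (norm_ne_zero_iff.mpr hx)
    rw [← norm_smul, ← hu, hnorm, hnorm, one_mul]
  have hsq : u * u = 1 := by
    have h := Complex.mul_conj' u
    rw [hconj, hunit] at h
    simpa using h
  exact mul_self_eq_one_iff.mp hsq
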